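/- For every positive integer n and all nonnegative integers k and l, the following polynomial identity in x_1,…,x_n holds: e_k(x_1,…,x_n) multiplied by the complete homogeneous symmetric polynomial of degree l in the variables {x_i x_j : 1 ≤ i ≤ j ≤ n} equals the sum of the Schur polynomials s_λ(x_1,…,x_n) over all partitions λ of k+2l having exactly k odd parts (odd rows). Here e_k is the elementary symmetric polynomial of degree k. -/

import Mathlib

/-- The weight of a semistandard Young tableau: `ssytWeight T i` is the number of cells of the
tableau whose entry equals `i`. -/
def ssytWeight {μ : YoungDiagram} (T : SemistandardYoungTableau μ) (i : ℕ) : ℕ :=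
  (μ.cells.filter fun c => T c.1 c.2 = i).card

/-- `tabCard μ ν` is the number of semistandard Young tableaux of shape `μ` and weight `ν`,
where `ν : Fin n → ℕ`: the entry `j` (for `j < n`) occurs exactly `ν j` times, and no entry
`≥ n` occurs. -/
noncomputable def tabCard (μ : YoungDiagram) {n : ℕ} (ν : Fin n → ℕ) : ℕ :=
  Set.ncard {T : SemistandardYoungTableau μ |
    ∀ j : ℕ, ssytWeight T j = if h : j < n then ν ⟨j, h⟩ else 0}

/-- The Schur polynomial `s_μ(x_0, …, x_{n-1})`, as the generating function of semistandard
Young tableaux of shape `μ` with entries in `{0, …, n-1}`. -/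
noncomputable def schurPoly (n : ℕ) (μ : YoungDiagram) : MvPolynomial (Fin n) ℤ :=
  ∑ᶠ (T : SemistandardYoungTableau μ) (_ : ∀ c ∈ μ.cells, T c.1 c.2 < n),
    ∏ i : Fin n, (MvPolynomial.X i : MvPolynomial (Fin n) ℤ) ^ ssytWeight T (i : ℕ)

/-- The number of odd rows (odd parts) of a Young diagram. -/
def oddRowsCount (lam : YoungDiagram) : ℕ :=
  lam.rowLens.countP fun r => r % 2 = 1

/-- The number of odd columns of a Young diagram. -/
def oddColsCount (lam : YoungDiagram) : ℕ :=
  oddRowsCount lam.transpose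

/-- A Young diagram is a *threshold* partition if its Frobenius coordinates satisfy
`β i = α i + 1` for each `i` up to the Durfee rank; with 0-indexed diagrams this says that
`colLen i = rowLen i + 1` for each diagonal cell `(i, i)`. -/
def YoungDiagram.IsThreshold (lam : YoungDiagram) : Prop :=
  ∀ i : ℕ, (i, i) ∈ lam → lam.colLen i = lam.rowLen i + 1

namespace YoungDiagram

/-- The Young diagram whose `i`-th row has length `f i`. -/
def ofRowLenFun (f : ℕ → ℕ) (hf : Antitone f) (N : ℕ) : YoungDiagram where
  cells := (Finset.range N ×ˢ Finset.range (f 0)).filter fun c => c.2 < f c.1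
  isLowerSet := by
    rintro ⟨a, b⟩ ⟨c, d⟩ h hab
    obtain ⟨h1, h2⟩ := Prod.mk_le_mk.mp h
    simp only [Finset.coe_filter, Finset.mem_product, Finset.mem_range, Set.mem_ofPred_eq] at hab ⊢
    have := hf h1
    omega

theorem rowLen_ofRowLenFun {f : ℕ → ℕ} (hf : Antitone f) {N : ℕ} (hN : ∀ i, N ≤ i → f i = 0)
    (i : ℕ) : (ofRowLenFun f hf N).rowLen i = f i := by
  have key : ∀ j, j < (ofRowLenFun f hf N).rowLen i ↔ j < f i := by
    intro j
    rw [← mem_iff_lt_rowLen]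
    rw [← mem_cells]
    simp only [ofRowLenFun, Finset.mem_filter, Finset.mem_product, Finset.mem_range,
      and_iff_right_iff_imp]
    intro h
    refine ⟨?_, h.trans_le (hf (Nat.zero_le i))⟩
    by_contra hi
    have := hN i (by omega)
    omega
  have h1 := key (f i)
  have h2 := key ((ofRowLenFun f hf N).rowLen i)
  omega

theorem ext_rowLen {μ ν : YoungDiagram} (h : ∀ i, μ.rowLen i = ν.rowLen i) : μ = ν := by
  ext ⟨i, j⟩
  simp only [mem_cells, mem_iff_lt_rowLen, h]

theorem rowLen_eq_zero (μ : YoungDiagram) {i : ℕ} (h : μ.colLen 0 ≤ i) : μ.rowLen i = 0 := by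
  by_contra h0
  have : (i, 0) ∈ μ := mem_iff_lt_rowLen.mpr (Nat.pos_of_ne_zero h0)
  rw [mem_iff_lt_colLen] at this
  omega

theorem card_eq_sum_rowLen (μ : YoungDiagram) {N : ℕ} (hN : μ.colLen 0 ≤ N) :
    μ.card = ∑ i ∈ Finset.range N, μ.rowLen i := by
  rw [YoungDiagram.card, Finset.card_eq_sum_card_fiberwise (f := Prod.fst) (t := Finset.range N)]
  · exact Finset.sum_congr rfl fun i _ => (μ.rowLen_eq_card).symm
  · rintro ⟨i, j⟩ h
    have h' : (i, j) ∈ μ := h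
    have : i < μ.colLen 0 := mem_iff_lt_colLen.mp (μ.up_left_mem le_rfl (Nat.zero_le j) h')
    simp only [Finset.coe_range, Set.mem_Iio]
    omega

theorem oddRowsCount_eq_sum (μ : YoungDiagram) {N : ℕ} (hN : μ.colLen 0 ≤ N) :
    oddRowsCount μ = ∑ i ∈ Finset.range N, μ.rowLen i % 2 := by
  have h1 : ∑ i ∈ Finset.range N, μ.rowLen i % 2
      = ∑ i ∈ Finset.range (μ.colLen 0), μ.rowLen i % 2 := by
    symm
    apply Finset.sum_subset (Finset.range_subset_range.mpr hN)
    intro i _ hi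
    rw [μ.rowLen_eq_zero (by simpa using hi), Nat.zero_mod]
  rw [h1, oddRowsCount, rowLens, List.countP_map]
  generalize μ.colLen 0 = M
  induction M with
  | zero => simp
  | succ M ih =>
    rw [List.range_succ, List.countP_append, ih, Finset.sum_range_succ]
    congr 1
    simp only [List.countP_singleton, Function.comp, decide_eq_true_eq]
    split_ifs <;> omega

/-- `κ.Interlaces μ` says that `κ ⊆ μ` and `μ / κ` is a horizontal strip. -/
def Interlaces (κ μ : YoungDiagram) : Prop :=
  ∀ i, μ.rowLen (i + 1) ≤ κ.rowLen i ∧ κ.rowLen i ≤ μ.rowLen i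

theorem Interlaces.colLen_le {κ μ : YoungDiagram} (h : κ.Interlaces μ) :
    κ.colLen 0 ≤ μ.colLen 0 := by
  by_contra hlt
  have h1 : (μ.colLen 0, 0) ∈ κ := mem_iff_lt_colLen.mpr (by omega)
  have h2 := mem_iff_lt_rowLen.mp h1
  have h3 := (h (μ.colLen 0)).2
  rw [μ.rowLen_eq_zero le_rfl] at h3
  omega

theorem Interlaces.card_le {κ μ : YoungDiagram} (h : κ.Interlaces μ) : κ.card ≤ μ.card := by
  rw [κ.card_eq_sum_rowLen h.colLen_le, μ.card_eq_sum_rowLen le_rfl]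
  exact Finset.sum_le_sum fun i _ => (h i).2

/-- Two diagrams interlacing from above: the local growth rule. -/
def growthUp (ν κ ρ : YoungDiagram) (c : ℕ) : ℕ → ℕ
  | 0 => max (ν.rowLen 0) (κ.rowLen 0) + c
  | i + 1 => min (ν.rowLen i) (κ.rowLen i) + max (ν.rowLen (i + 1)) (κ.rowLen (i + 1)) - ρ.rowLen i

/-- The inverse of the local growth rule. -/
def growthDown (ν κ μ : YoungDiagram) (i : ℕ) : ℕ :=
  min (ν.rowLen i) (κ.rowLen i) + max (ν.rowLen (i + 1)) (κ.rowLen (i + 1)) - μ.rowLen (i + 1)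

theorem antitone_growthUp {ν κ ρ : YoungDiagram} (hν : ρ.Interlaces ν) (hκ : ρ.Interlaces κ)
    (c : ℕ) : Antitone (growthUp ν κ ρ c) := by
  apply antitone_nat_of_succ_le
  intro n
  cases n with
  | zero =>
    simp only [growthUp]
    have := hν 0; have := hκ 0; omega
  | succ n =>
    simp only [growthUp]
    have := hν n; have := hκ n; have := hν (n+1); have := hκ (n+1); omega

theorem antitone_growthDown {ν κ μ : YoungDiagram} (hν : ν.Interlaces μ) (hκ : κ.Interlaces μ) :
    Antitone (growthDown ν κ μ) := by
  apply antitone_nat_of_succ_le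
  intro n
  simp only [growthDown]
  have := hν n; have := hκ n; have := hν (n + 1); have := hκ (n + 1)
  have := (hν (n + 1 + 1)).2; have := (hκ (n + 1 + 1)).2
  omega

theorem growthUp_eq_zero {ν κ ρ : YoungDiagram} (c : ℕ) {i : ℕ}
    (hi : ν.colLen 0 + κ.colLen 0 + 1 ≤ i) : growthUp ν κ ρ c i = 0 := by
  obtain ⟨i, rfl⟩ : ∃ j, i = j + 1 := ⟨i - 1, by omega⟩
  simp only [growthUp]
  rw [ν.rowLen_eq_zero (i := i) (by omega), ν.rowLen_eq_zero (i := i + 1) (by omega),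
    κ.rowLen_eq_zero (i := i) (by omega), κ.rowLen_eq_zero (i := i + 1) (by omega)]
  simp

theorem growthDown_eq_zero {ν κ μ : YoungDiagram} {i : ℕ}
    (hi : ν.colLen 0 + κ.colLen 0 + 1 ≤ i) : growthDown ν κ μ i = 0 := by
  simp only [growthDown]
  rw [ν.rowLen_eq_zero (i := i) (by omega), ν.rowLen_eq_zero (i := i + 1) (by omega),
    κ.rowLen_eq_zero (i := i) (by omega), κ.rowLen_eq_zero (i := i + 1) (by omega)]
  simp

/-- The local growth bijection. -/
def growthEquiv (ν κ : YoungDiagram) :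
    {μ : YoungDiagram // ν.Interlaces μ ∧ κ.Interlaces μ} ≃
      ℕ × {ρ : YoungDiagram // ρ.Interlaces ν ∧ ρ.Interlaces κ} where
  toFun μ := ⟨μ.1.rowLen 0 - max (ν.rowLen 0) (κ.rowLen 0),
    ⟨ofRowLenFun (growthDown ν κ μ.1) (antitone_growthDown μ.2.1 μ.2.2)
      (ν.colLen 0 + κ.colLen 0 + 1), by
      constructor
      all_goals
        intro i
        rw [rowLen_ofRowLenFun _ fun i hi => growthDown_eq_zero hi]
        simp only [growthDown]
        have := μ.2.1 i; have := μ.2.2 i; have := μ.2.1 (i + 1); have := μ.2.2 (i + 1)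
        omega⟩⟩
  invFun p := ⟨ofRowLenFun (growthUp ν κ p.2.1 p.1) (antitone_growthUp p.2.2.1 p.2.2.2 p.1)
      (ν.colLen 0 + κ.colLen 0 + 1), by
      constructor
      all_goals
        intro i
        rw [rowLen_ofRowLenFun _ fun i hi => growthUp_eq_zero _ hi,
          rowLen_ofRowLenFun _ fun i hi => growthUp_eq_zero _ hi]
        have := p.2.2.1 i; have := p.2.2.2 i
        cases i with
        | zero => simp only [growthUp]; omega
        | succ i =>
          have := p.2.2.1 i; have := p.2.2.2 i
          simp only [growthUp]; omega⟩
  left_inv μ := by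
    apply Subtype.ext
    apply ext_rowLen
    intro i
    rw [rowLen_ofRowLenFun _ fun i hi => growthUp_eq_zero _ hi]
    cases i with
    | zero =>
      have := μ.2.1 0; have := μ.2.2 0
      simp only [growthUp]; omega
    | succ i =>
      simp only [growthUp]
      rw [rowLen_ofRowLenFun _ fun i hi => growthDown_eq_zero hi]
      simp only [growthDown]
      have := μ.2.1 i; have := μ.2.2 i; have := μ.2.1 (i + 1); have := μ.2.2 (i + 1)
      omega
  right_inv p := by
    refine Prod.ext ?_ (Subtype.ext (ext_rowLen fun i => ?_))
    · dsimp only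
      rw [rowLen_ofRowLenFun _ fun i hi => growthUp_eq_zero _ hi]
      simp only [growthUp]; omega
    · dsimp only
      rw [rowLen_ofRowLenFun _ fun i hi => growthDown_eq_zero hi]
      simp only [growthDown]
      rw [rowLen_ofRowLenFun _ fun i hi => growthUp_eq_zero _ hi]
      have := p.2.2.1 i; have := p.2.2.2 i
      simp only [growthUp]; omega

theorem card_growthEquiv_symm {ν κ : YoungDiagram}
    (p : ℕ × {ρ : YoungDiagram // ρ.Interlaces ν ∧ ρ.Interlaces κ}) :
    ((growthEquiv ν κ).symm p).1.card + p.2.1.card = ν.card + κ.card + p.1 := by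
  obtain ⟨c, ρ, hν, hκ⟩ := p
  set μ := ((growthEquiv ν κ).symm (c, ⟨ρ, hν, hκ⟩)).1 with hμ
  have hrow : ∀ i, μ.rowLen i = growthUp ν κ ρ c i :=
    rowLen_ofRowLenFun (antitone_growthUp hν hκ c) fun i hi => growthUp_eq_zero _ hi
  set N := μ.colLen 0 + ν.colLen 0 + κ.colLen 0 + ρ.colLen 0 with hN
  rw [μ.card_eq_sum_rowLen (N := N + 1) (by omega), ρ.card_eq_sum_rowLen (N := N) (by omega),
    ν.card_eq_sum_rowLen (N := N + 1) (by omega), κ.card_eq_sum_rowLen (N := N + 1) (by omega),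
    Finset.sum_range_succ']
  have h1 : ∑ i ∈ Finset.range N, μ.rowLen (i + 1) + ∑ i ∈ Finset.range N, ρ.rowLen i =
      ∑ i ∈ Finset.range N, min (ν.rowLen i) (κ.rowLen i) +
      ∑ i ∈ Finset.range N, max (ν.rowLen (i + 1)) (κ.rowLen (i + 1)) := by
    rw [← Finset.sum_add_distrib, ← Finset.sum_add_distrib]
    refine Finset.sum_congr rfl fun i _ => ?_
    rw [hrow]
    have := hν i; have := hκ i
    simp only [growthUp]; omega
  have h2 := Finset.sum_range_succ' (fun i => max (ν.rowLen i) (κ.rowLen i)) N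
  have h3 := Finset.sum_range_succ (fun i => min (ν.rowLen i) (κ.rowLen i)) N
  have h4 : ∑ i ∈ Finset.range (N + 1), min (ν.rowLen i) (κ.rowLen i) +
      ∑ i ∈ Finset.range (N + 1), max (ν.rowLen i) (κ.rowLen i) =
      ∑ i ∈ Finset.range (N + 1), ν.rowLen i + ∑ i ∈ Finset.range (N + 1), κ.rowLen i := by
    rw [← Finset.sum_add_distrib, ← Finset.sum_add_distrib]
    exact Finset.sum_congr rfl fun i _ => min_add_max _ _
  have h5 : μ.rowLen 0 = max (ν.rowLen 0) (κ.rowLen 0) + c := hrow 0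
  have h6 := ν.rowLen_eq_zero (i := N) (by omega)
  simp only [h6, Nat.zero_min] at h3
  omega

end YoungDiagram

namespace YoungDiagram

open scoped ENNReal

theorem tsum_ite_eq_tsum_subtype {α : Type*} (P : α → Prop) [DecidablePred P] (f : α → ℝ≥0∞) :
    ∑' a, (if P a then f a else 0) = ∑' a : {a // P a}, f a := by
  refine Eq.trans (tsum_congr fun a => ?_) (tsum_subtype {a | P a} f).symm
  by_cases h : P a <;> simp [h]

open Classical in
/-- The weight `y ^ |μ / κ|` of a horizontal strip, and `0` if `μ / κ` is not a horizontal strip. -/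
noncomputable def stripWeight (y : ℝ≥0∞) (κ μ : YoungDiagram) : ℝ≥0∞ :=
  if κ.Interlaces μ then y ^ (μ.card - κ.card) else 0

theorem tsum_stripWeight_mul_stripWeight (x y : ℝ≥0∞) (ν κ : YoungDiagram) :
    ∑' μ, stripWeight y ν μ * stripWeight x κ μ =
      (∑' c : ℕ, (x * y) ^ c) * ∑' ρ, stripWeight y ρ κ * stripWeight x ρ ν := by
  classical
  have h1 : ∀ μ, stripWeight y ν μ * stripWeight x κ μ =
      if ν.Interlaces μ ∧ κ.Interlaces μ then
        y ^ (μ.card - ν.card) * x ^ (μ.card - κ.card) else 0 := by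
    intro μ
    by_cases h1 : ν.Interlaces μ <;> by_cases h2 : κ.Interlaces μ <;> simp [stripWeight, h1, h2]
  have h2 : ∀ ρ, stripWeight y ρ κ * stripWeight x ρ ν =
      if ρ.Interlaces ν ∧ ρ.Interlaces κ then
        y ^ (κ.card - ρ.card) * x ^ (ν.card - ρ.card) else 0 := by
    intro μ
    by_cases h1 : μ.Interlaces ν <;> by_cases h2 : μ.Interlaces κ <;> simp [stripWeight, h1, h2]
  simp only [h1, h2]
  rw [tsum_ite_eq_tsum_subtype, tsum_ite_eq_tsum_subtype, ← (growthEquiv ν κ).symm.tsum_eq,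
    ENNReal.tsum_prod', ← ENNReal.tsum_mul_right]
  refine tsum_congr fun c => ?_
  rw [← ENNReal.tsum_mul_left]
  refine tsum_congr fun ρ => ?_
  have h3 := card_growthEquiv_symm (c, ρ)
  have h4 := ρ.2.1.card_le
  have h5 := ρ.2.2.card_le
  simp only at h3
  rw [show (((growthEquiv ν κ).symm (c, ρ)).1.card - ν.card) = c + (κ.card - ρ.1.card) by omega,
    show (((growthEquiv ν κ).symm (c, ρ)).1.card - κ.card) = c + (ν.card - ρ.1.card) by omega]
  ring

/-- Diagrams obtained by removing a horizontal strip have independent row lengths. -/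
def interlacesEquiv (μ : YoungDiagram) :
    {ν : YoungDiagram // ν.Interlaces μ} ≃
      Fintype.piFinset fun i : Fin (μ.colLen 0) =>
        Finset.Icc (μ.rowLen (i + 1)) (μ.rowLen i) where
  toFun ν := ⟨fun i => ν.1.rowLen i, by
    simp only [Fintype.mem_piFinset, Finset.mem_Icc]
    exact fun i => ν.2 i⟩
  invFun p := ⟨ofRowLenFun (fun i => if h : i < μ.colLen 0 then p.1 ⟨i, h⟩ else 0) (by
      apply antitone_nat_of_succ_le
      intro i
      have hp := p.2
      simp only [Fintype.mem_piFinset, Finset.mem_Icc] at hp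
      split_ifs with h1 h2
      · exact (hp ⟨i + 1, h1⟩).2.trans (hp ⟨i, h2⟩).1
      · omega
      · exact Nat.zero_le _
      · exact le_rfl) (μ.colLen 0), by
    intro i
    rw [rowLen_ofRowLenFun _ fun i hi => dif_neg (by omega)]
    have hp := p.2
    simp only [Fintype.mem_piFinset, Finset.mem_Icc] at hp
    split_ifs with h
    · exact hp ⟨i, h⟩
    · have := μ.rowLen_eq_zero (i := i + 1) (by omega)
      omega⟩
  left_inv ν := by
    apply Subtype.ext
    apply ext_rowLen
    intro i
    dsimp only
    rw [rowLen_ofRowLenFun _ fun i hi => dif_neg (by omega)]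
    split_ifs with h
    · rfl
    · have := μ.rowLen_eq_zero (i := i) (by omega)
      have := ν.2 i
      omega
  right_inv p := by
    apply Subtype.ext
    funext i
    dsimp only
    rw [rowLen_ofRowLenFun _ fun i hi => dif_neg (by omega), dif_pos i.2]

theorem tsum_prod_rowLen (μ : YoungDiagram) (f : ℕ → ℕ → ℝ≥0∞) :
    ∑' ν : {ν : YoungDiagram // ν.Interlaces μ},
        ∏ i ∈ Finset.range (μ.colLen 0), f i (ν.1.rowLen i) =
      ∏ i ∈ Finset.range (μ.colLen 0),
        ∑ a ∈ Finset.Icc (μ.rowLen (i + 1)) (μ.rowLen i), f i a := by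
  rw [Finset.prod_range, Finset.prod_univ_sum, ← Finset.tsum_subtype,
    ← (interlacesEquiv μ).tsum_eq]
  refine tsum_congr fun ν => ?_
  rw [Finset.prod_range]
  rfl

theorem sum_range_pow_mod_two {R : Type*} [CommSemiring R] (t y : R) (p m : ℕ) :
    ∑ k ∈ Finset.range (2 * m), t ^ ((p + k) % 2) * y ^ k =
      (t ^ (p % 2) + t ^ ((p + 1) % 2) * y) * ∑ j ∈ Finset.range m, y ^ (2 * j) := by
  induction m with
  | zero => simp
  | succ m ih =>
    rw [show 2 * (m + 1) = 2 * m + 1 + 1 by ring, Finset.sum_range_succ, Finset.sum_range_succ, ih,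
      Finset.sum_range_succ, show (p + 2 * m) % 2 = p % 2 by omega,
      show (p + (2 * m + 1)) % 2 = (p + 1) % 2 by omega]
    ring

theorem mul_sum_Icc_pow_mod_two {R : Type*} [CommSemiring R] (t y : R) {p q : ℕ} (h : p ≤ q) :
    (t ^ (q % 2) + t ^ ((q + 1) % 2) * y) *
        ∑ a ∈ Finset.Icc p q, t ^ ((q + p - a) % 2) * y ^ (q - a) =
      (t ^ (p % 2) + t ^ ((p + 1) % 2) * y) *
        ∑ a ∈ Finset.Icc p q, t ^ (a % 2) * y ^ (q - a) := by
  obtain ⟨d, rfl⟩ := Nat.exists_eq_add_of_le h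
  have reindex : ∀ f : ℕ → R, ∑ a ∈ Finset.Icc p (p + d), f a =
      ∑ k ∈ Finset.range (d + 1), f (p + d - k) := by
    intro f
    rw [← Finset.Ico_add_one_right_eq_Icc, Finset.sum_Ico_eq_sum_range, ← Finset.sum_range_reflect]
    rw [show p + d + 1 - p = d + 1 by omega]
    refine Finset.sum_congr rfl fun k hk => ?_
    rw [Finset.mem_range] at hk
    congr 1
    omega
  rw [reindex, reindex]
  have h1 : ∑ k ∈ Finset.range (d + 1),
      t ^ ((p + d + p - (p + d - k)) % 2) * y ^ (p + d - (p + d - k)) =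
      ∑ k ∈ Finset.range (d + 1), t ^ ((p + k) % 2) * y ^ k := by
    refine Finset.sum_congr rfl fun k hk => ?_
    rw [Finset.mem_range] at hk
    congr 2
    · congr 1; omega
    · omega
  have h2 : ∑ k ∈ Finset.range (d + 1),
      t ^ ((p + d - k) % 2) * y ^ (p + d - (p + d - k)) =
      ∑ k ∈ Finset.range (d + 1), t ^ ((p + d + k) % 2) * y ^ k := by
    refine Finset.sum_congr rfl fun k hk => ?_
    rw [Finset.mem_range] at hk
    congr 2
    · omega
    · omega
  rw [h1, h2]
  obtain ⟨m, rfl | rfl⟩ := Nat.even_or_odd' d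
  · have h3 : ∀ k, (p + 2 * m + k) % 2 = (p + k) % 2 := fun k => by omega
    simp only [h3, show (p + 2 * m) % 2 = p % 2 by omega]
  · rw [show 2 * m + 1 + 1 = 2 * (m + 1) by ring, sum_range_pow_mod_two, sum_range_pow_mod_two]
    ring

theorem tsum_pow_mod_two (t y : ℝ≥0∞) (p : ℕ) :
    ∑' c : ℕ, t ^ ((p + c) % 2) * y ^ c =
      (t ^ (p % 2) + t ^ ((p + 1) % 2) * y) * ∑' c : ℕ, (y * y) ^ c := by
  rw [← tsum_even_add_odd ENNReal.summable ENNReal.summable, ← ENNReal.tsum_mul_left,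
    ← ENNReal.tsum_add]
  refine tsum_congr fun c => ?_
  rw [show (p + 2 * c) % 2 = p % 2 by omega, show (p + (2 * c + 1)) % 2 = (p + 1) % 2 by omega]
  ring

theorem card_sub_card_eq_sum {ν μ : YoungDiagram} (h : ν.Interlaces μ) :
    μ.card - ν.card = ∑ i ∈ Finset.range (μ.colLen 0), (μ.rowLen i - ν.rowLen i) := by
  rw [ν.card_eq_sum_rowLen h.colLen_le, μ.card_eq_sum_rowLen le_rfl,
    ← Finset.sum_tsub_distrib _ fun i _ => (h i).2]

theorem colLen_le_of_interlaces {μ lam : YoungDiagram} (h : μ.Interlaces lam) :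
    lam.colLen 0 ≤ μ.colLen 0 + 1 := by
  by_contra hlt
  have h1 : (μ.colLen 0 + 1, 0) ∈ lam := mem_iff_lt_colLen.mpr (by omega)
  have h2 := mem_iff_lt_rowLen.mp h1
  have h3 := (h (μ.colLen 0)).1
  rw [μ.rowLen_eq_zero le_rfl] at h3
  omega

theorem rowLen_growthEquiv_symm {ν κ : YoungDiagram}
    (p : ℕ × {ρ : YoungDiagram // ρ.Interlaces ν ∧ ρ.Interlaces κ}) (i : ℕ) :
    ((growthEquiv ν κ).symm p).1.rowLen i = growthUp ν κ p.2.1 p.1 i :=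
  rowLen_ofRowLenFun (antitone_growthUp p.2.2.1 p.2.2.2 p.1)
    (fun _ hi => growthUp_eq_zero _ hi) i

theorem prod_range_telescope {R : Type*} [CommSemiring R] (g A B : ℕ → R)
    (h : ∀ i, g i * A i = g (i + 1) * B i) (N : ℕ) :
    g 0 * ∏ i ∈ Finset.range N, A i = g N * ∏ i ∈ Finset.range N, B i := by
  induction N with
  | zero => simp
  | succ N ih =>
    rw [Finset.prod_range_succ, Finset.prod_range_succ, ← mul_assoc, ih, mul_right_comm, h]
    ring

theorem tsum_stripWeight_mul_pow_oddRowsCount (t y : ℝ≥0∞) (μ : YoungDiagram) :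
    ∑' lam, stripWeight y μ lam * t ^ oddRowsCount lam =
      ((1 + t * y) * ∑' c : ℕ, (y * y) ^ c) *
        ∑' ν, stripWeight y ν μ * t ^ oddRowsCount ν := by
  classical
  have h1 : ∀ lam, stripWeight y μ lam * t ^ oddRowsCount lam =
      if μ.Interlaces lam ∧ μ.Interlaces lam then
        y ^ (lam.card - μ.card) * t ^ oddRowsCount lam else 0 := by
    intro lam
    by_cases h1 : μ.Interlaces lam <;> simp [stripWeight, h1]
  have h2 : ∀ ν, stripWeight y ν μ * t ^ oddRowsCount ν =
      if ν.Interlaces μ then y ^ (μ.card - ν.card) * t ^ oddRowsCount ν else 0 := by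
    intro lam
    by_cases h1 : lam.Interlaces μ <;> simp [stripWeight, h1]
  simp only [h1, h2]
  rw [tsum_ite_eq_tsum_subtype, tsum_ite_eq_tsum_subtype]
  have hR : ∀ ν : {ν : YoungDiagram // ν.Interlaces μ},
      y ^ (μ.card - ν.1.card) * t ^ oddRowsCount ν.1 =
      ∏ i ∈ Finset.range (μ.colLen 0),
        (fun i a => t ^ (a % 2) * y ^ (μ.rowLen i - a)) i (ν.1.rowLen i) := by
    intro ν
    rw [card_sub_card_eq_sum ν.2, oddRowsCount_eq_sum _ ν.2.colLen_le, Finset.prod_mul_distrib,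
      Finset.prod_pow_eq_pow_sum, Finset.prod_pow_eq_pow_sum, mul_comm]
  rw [tsum_congr hR, tsum_prod_rowLen μ (fun i a => t ^ (a % 2) * y ^ (μ.rowLen i - a))]
  have hL : ∀ (c : ℕ) (ρ : {ρ : YoungDiagram // ρ.Interlaces μ ∧ ρ.Interlaces μ}),
      y ^ (((growthEquiv μ μ).symm (c, ρ)).1.card - μ.card) *
        t ^ oddRowsCount ((growthEquiv μ μ).symm (c, ρ)).1 =
      t ^ ((μ.rowLen 0 + c) % 2) * y ^ c * ∏ i ∈ Finset.range (μ.colLen 0),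
        (fun i a => t ^ ((μ.rowLen i + μ.rowLen (i + 1) - a) % 2) * y ^ (μ.rowLen i - a)) i
          (ρ.1.rowLen i) := by
    intro c ρ
    have h3 := card_growthEquiv_symm (c, ρ)
    have h4 := ρ.2.1.card_le
    simp only at h3
    rw [show (((growthEquiv μ μ).symm (c, ρ)).1.card - μ.card) = c + (μ.card - ρ.1.card) by omega,
      card_sub_card_eq_sum ρ.2.1,
      oddRowsCount_eq_sum _ (colLen_le_of_interlaces ((growthEquiv μ μ).symm (c, ρ)).2.1),
      Finset.sum_range_succ', Finset.prod_mul_distrib,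
      Finset.prod_pow_eq_pow_sum, Finset.prod_pow_eq_pow_sum, pow_add, pow_add]
    simp only [rowLen_growthEquiv_symm, growthUp, max_self, min_self]
    ring
  rw [← (growthEquiv μ μ).symm.tsum_eq, ENNReal.tsum_prod']
  simp only [hL, ENNReal.tsum_mul_left, ENNReal.tsum_mul_right]
  have hE := (Equiv.subtypeEquivRight (p := fun ρ : YoungDiagram => ρ.Interlaces μ ∧ ρ.Interlaces μ)
    (q := fun ρ => ρ.Interlaces μ) fun ρ => and_self_iff).tsum_eq
    (fun ν : {ν : YoungDiagram // ν.Interlaces μ} => ∏ i ∈ Finset.range (μ.colLen 0),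
        (fun i a => t ^ ((μ.rowLen i + μ.rowLen (i + 1) - a) % 2) * y ^ (μ.rowLen i - a)) i
          (ν.1.rowLen i))
  rw [tsum_prod_rowLen μ
    (fun i a => t ^ ((μ.rowLen i + μ.rowLen (i + 1) - a) % 2) * y ^ (μ.rowLen i - a))] at hE
  simp only [Equiv.subtypeEquivRight_apply_coe] at hE
  rw [hE, tsum_pow_mod_two]
  have key := prod_range_telescope
    (fun i => t ^ (μ.rowLen i % 2) + t ^ ((μ.rowLen i + 1) % 2) * y) _ _
    (fun i => mul_sum_Icc_pow_mod_two t y (μ.rowLen_anti i (i + 1) (Nat.le_succ i))) (μ.colLen 0)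
  simp only [μ.rowLen_eq_zero le_rfl, Nat.zero_mod, pow_zero, zero_add, Nat.one_mod, pow_one] at key
  rw [mul_right_comm, key]
  ring

end YoungDiagram

namespace YoungDiagram

open scoped ENNReal

/-- Semistandard tableaux of shape `μ` with entries less than `n`. -/
abbrev BoundedTableau (n : ℕ) (μ : YoungDiagram) : Type :=
  {T : SemistandardYoungTableau μ // ∀ c ∈ μ.cells, T c.1 c.2 < n}

/-- The generating function of tableaux of shape `μ` with entries less than `n`, evaluated at
extended nonnegative reals. -/
noncomputable def schurSum (n : ℕ) (x : ℕ → ℝ≥0∞) (μ : YoungDiagram) : ℝ≥0∞ :=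
  ∑' T : BoundedTableau n μ, ∏ c ∈ μ.cells, x (T.1 c.1 c.2)

/-- The cells of a tableau whose entries are less than `n`. -/
def innerShape {μ : YoungDiagram} (T : SemistandardYoungTableau μ) (n : ℕ) : YoungDiagram where
  cells := μ.cells.filter fun c => T c.1 c.2 < n
  isLowerSet := by
    rintro ⟨a, b⟩ ⟨c, d⟩ h hab
    obtain ⟨h1, h2⟩ := Prod.mk_le_mk.mp h
    simp only [Finset.coe_filter, mem_cells, Set.mem_ofPred_eq] at hab ⊢
    refine ⟨μ.up_left_mem h1 h2 hab.1, lt_of_le_of_lt ?_ hab.2⟩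
    exact (T.row_weak_of_le h2 (μ.up_left_mem h1 le_rfl hab.1)).trans (T.col_weak h1 hab.1)

theorem mem_innerShape {μ : YoungDiagram} (T : SemistandardYoungTableau μ) (n i j : ℕ) :
    (i, j) ∈ innerShape T n ↔ (i, j) ∈ μ ∧ T i j < n := by
  rw [← mem_cells]
  simp [innerShape]

theorem innerShape_interlaces {n : ℕ} {μ : YoungDiagram} (T : BoundedTableau (n + 1) μ) :
    (innerShape T.1 n).Interlaces μ := by
  intro i
  constructor
  · by_contra! h
    have h1 := mem_iff_lt_rowLen.mpr h
    have h2 := T.1.col_strict (Nat.lt_add_one i) h1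
    have h3 := T.2 _ h1
    have h4 : (i, (innerShape T.1 n).rowLen i) ∈ innerShape T.1 n := by
      rw [mem_innerShape]
      simp only at h3
      exact ⟨μ.up_left_mem (Nat.le_succ i) le_rfl h1, by omega⟩
    exact lt_irrefl _ (mem_iff_lt_rowLen.mp h4)
  · by_contra! h
    have h1 := (mem_innerShape _ _ _ _).mp (mem_iff_lt_rowLen.mpr h)
    exact lt_irrefl _ (mem_iff_lt_rowLen.mp h1.1)

theorem Interlaces.mem_of_mem {κ μ : YoungDiagram} (h : κ.Interlaces μ) {i j : ℕ}
    (hc : (i, j) ∈ κ) : (i, j) ∈ μ :=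
  mem_iff_lt_rowLen.mpr ((mem_iff_lt_rowLen.mp hc).trans_le (h i).2)

/-- Restriction of a tableau to a smaller shape. -/
def restrictTableau {κ μ : YoungDiagram} (T : SemistandardYoungTableau μ) (h : κ.Interlaces μ) :
    SemistandardYoungTableau κ where
  entry i j := if (i, j) ∈ κ then T i j else 0
  row_weak' := by
    intro i j1 j2 hj hc
    rw [if_pos hc, if_pos (κ.up_left_mem le_rfl hj.le hc)]
    exact T.row_weak hj (h.mem_of_mem hc)
  col_strict' := by
    intro i1 i2 j hi hc
    rw [if_pos hc, if_pos (κ.up_left_mem hi.le le_rfl hc)]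
    exact T.col_strict hi (h.mem_of_mem hc)
  zeros' := fun hc => if_neg hc

/-- Extension of a tableau by a horizontal strip filled with `n`. -/
def extendTableau {n : ℕ} {κ μ : YoungDiagram} (T : BoundedTableau n κ) (h : κ.Interlaces μ) :
    SemistandardYoungTableau μ where
  entry i j := if (i, j) ∈ κ then T.1 i j else if (i, j) ∈ μ then n else 0
  row_weak' := by
    intro i j1 j2 hj hc
    by_cases h2 : (i, j2) ∈ κ
    · rw [if_pos h2, if_pos (κ.up_left_mem le_rfl hj.le h2)]
      exact T.1.row_weak hj h2
    · rw [if_neg h2, if_pos hc]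
      by_cases h1 : (i, j1) ∈ κ
      · rw [if_pos h1]
        exact (T.2 _ h1).le
      · rw [if_neg h1]
        split_ifs <;> omega
  col_strict' := by
    intro i1 i2 j hi hc
    have h1 : (i1, j) ∈ κ := by
      rw [mem_iff_lt_rowLen] at hc ⊢
      exact hc.trans_le ((μ.rowLen_anti _ _ hi).trans (h i1).1)
    rw [if_pos h1]
    by_cases h2 : (i2, j) ∈ κ
    · rw [if_pos h2]
      exact T.1.col_strict hi h2
    · rw [if_neg h2, if_pos hc]
      exact T.2 _ h1
  zeros' := by
    intro i j hc
    rw [if_neg fun h' => hc (h.mem_of_mem h'), if_neg hc]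

theorem restrictTableau_apply {κ μ : YoungDiagram} (T : SemistandardYoungTableau μ)
    (h : κ.Interlaces μ) (i j : ℕ) :
    restrictTableau T h i j = if (i, j) ∈ κ then T i j else 0 := rfl

theorem extendTableau_apply {n : ℕ} {κ μ : YoungDiagram} (T : BoundedTableau n κ)
    (h : κ.Interlaces μ) (i j : ℕ) :
    extendTableau T h i j = if (i, j) ∈ κ then T.1 i j else if (i, j) ∈ μ then n else 0 := rfl

/-- Tableaux with a prescribed subtableau shape correspond to tableaux of that shape. -/
def innerShapeEquiv (n : ℕ) {κ μ : YoungDiagram} (h : κ.Interlaces μ) :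
    {T : BoundedTableau (n + 1) μ // innerShape T.1 n = κ} ≃ BoundedTableau n κ where
  toFun T := ⟨restrictTableau T.1.1 h, by
    rintro ⟨i, j⟩ hc
    rw [mem_cells] at hc
    rw [restrictTableau_apply, if_pos hc]
    rw [← T.2, mem_innerShape] at hc
    exact hc.2⟩
  invFun T := ⟨⟨extendTableau T h, by
      rintro ⟨i, j⟩ hc
      rw [mem_cells] at hc
      rw [extendTableau_apply, if_pos hc]
      split_ifs with h1
      · exact (T.2 _ h1).trans (Nat.lt_succ_self n)
      · exact Nat.lt_succ_self n⟩, by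
    ext ⟨i, j⟩
    rw [mem_cells, mem_cells, mem_innerShape, extendTableau_apply]
    by_cases h1 : (i, j) ∈ κ
    · simp only [h1, if_true, iff_true]
      exact ⟨h.mem_of_mem h1, T.2 _ h1⟩
    · simp only [h1, if_false, iff_false, not_and]
      intro h2
      simp [h2]⟩
  left_inv T := by
    apply Subtype.ext
    apply Subtype.ext
    ext i j
    dsimp only
    rw [extendTableau_apply]
    split_ifs with h1 h2
    · exact if_pos h1
    · have h3 := T.1.2 _ h2
      rw [← T.2, mem_innerShape] at h1
      simp only [h2, true_and] at h1
      simp only at h3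
      omega
    · exact (T.1.1.zeros h2).symm
  right_inv T := by
    apply Subtype.ext
    ext i j
    dsimp only
    rw [restrictTableau_apply, extendTableau_apply]
    split_ifs with h1
    · rfl
    · exact (T.1.zeros h1).symm

theorem schurSum_succ (n : ℕ) (x : ℕ → ℝ≥0∞) (μ : YoungDiagram) :
    schurSum (n + 1) x μ = ∑' κ, stripWeight (x n) κ μ * schurSum n x κ := by
  rw [schurSum, ← (Equiv.sigmaFiberEquiv fun T : BoundedTableau (n + 1) μ =>
    innerShape T.1 n).tsum_eq, ENNReal.tsum_sigma']
  refine tsum_congr fun κ => ?_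
  by_cases h : κ.Interlaces μ
  · rw [stripWeight, if_pos h, schurSum, ← ENNReal.tsum_mul_left, ← (innerShapeEquiv n h).tsum_eq]
    refine tsum_congr fun T => ?_
    have hsub : κ.cells ⊆ μ.cells := fun c hc => h.mem_of_mem hc
    rw [← Finset.prod_sdiff hsub]
    congr 1
    · rw [Finset.prod_congr rfl (g := fun _ => x n), Finset.prod_const,
        Finset.card_sdiff_of_subset hsub]
      rintro ⟨i, j⟩ hc
      obtain ⟨h2, h1⟩ := Finset.mem_sdiff.mp hc
      rw [mem_cells] at h1 h2
      have h3 := T.1.2 _ h2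
      rw [← T.2, mem_innerShape] at h1
      simp only [h2, true_and] at h1
      simp only at h3
      congr 1
      simp only [Equiv.sigmaFiberEquiv, Equiv.coe_fn_mk]
      omega
    · refine Finset.prod_congr rfl ?_
      rintro ⟨i, j⟩ hc
      exact congrArg x (if_pos hc).symm
  · rw [stripWeight, if_neg h, zero_mul]
    have : IsEmpty {T : BoundedTableau (n + 1) μ // innerShape T.1 n = κ} :=
      ⟨fun T => h (T.2 ▸ innerShape_interlaces T.1)⟩
    exact tsum_empty

theorem eq_bot_of_boundedTableau_zero {μ : YoungDiagram} (T : BoundedTableau 0 μ) : μ = ⊥ := by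
  ext c
  simp only [cells_bot, Finset.notMem_empty, iff_false]
  exact fun hc => Nat.not_lt_zero _ (T.2 c hc)

theorem schurSum_zero_of_ne_bot (x : ℕ → ℝ≥0∞) {μ : YoungDiagram} (h : μ ≠ ⊥) :
    schurSum 0 x μ = 0 := by
  have : IsEmpty (BoundedTableau 0 μ) := ⟨fun T => h (eq_bot_of_boundedTableau_zero T)⟩
  exact tsum_empty

theorem schurSum_zero_bot (x : ℕ → ℝ≥0∞) : schurSum 0 x ⊥ = 1 := by
  have hsub : Subsingleton (BoundedTableau 0 ⊥) := ⟨fun T T' => by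
    apply Subtype.ext
    ext i j
    rw [T.1.zeros (notMem_bot _), T'.1.zeros (notMem_bot _)]⟩
  let T : BoundedTableau 0 ⊥ := ⟨⟨fun _ _ => 0, fun _ h => absurd h (notMem_bot _),
    fun _ h => absurd h (notMem_bot _), fun _ => rfl⟩, fun c hc => absurd hc (notMem_bot _)⟩
  rw [schurSum, tsum_eq_single T fun T' h => absurd (Subsingleton.elim T' T) h]
  simp

theorem Interlaces.eq_bot {ν : YoungDiagram} (h : ν.Interlaces ⊥) : ν = ⊥ := by
  ext ⟨i, j⟩
  simp only [cells_bot, Finset.notMem_empty, iff_false]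
  exact fun hc => notMem_bot _ (h.mem_of_mem hc)

theorem bot_interlaces_bot : (⊥ : YoungDiagram).Interlaces ⊥ := by
  have h : ∀ i, (⊥ : YoungDiagram).rowLen i = 0 := by
    intro i
    by_contra h0
    exact notMem_bot _ (mem_iff_lt_rowLen.mpr (Nat.pos_of_ne_zero h0))
  intro i
  simp [h]

theorem tsum_stripWeight_mul_schurSum (n : ℕ) (x : ℕ → ℝ≥0∞) (y : ℝ≥0∞) (ν : YoungDiagram) :
    ∑' μ, stripWeight y ν μ * schurSum n x μ =
      (∏ i ∈ Finset.range n, ∑' c : ℕ, (x i * y) ^ c) * schurSum n x ν := by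
  induction n generalizing ν with
  | zero =>
    rw [tsum_eq_single ⊥ fun μ h => by rw [schurSum_zero_of_ne_bot x h, mul_zero],
      schurSum_zero_bot, Finset.prod_range_zero, one_mul, mul_one, stripWeight]
    by_cases h : ν = ⊥
    · rw [h, if_pos bot_interlaces_bot, schurSum_zero_bot]
      simp
    · rw [if_neg fun h' => h h'.eq_bot, schurSum_zero_of_ne_bot x h]
  | succ n ih =>
    calc ∑' μ, stripWeight y ν μ * schurSum (n + 1) x μ
        = ∑' κ, (∑' μ, stripWeight y ν μ * stripWeight (x n) κ μ) * schurSum n x κ := by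
          simp only [schurSum_succ, ← ENNReal.tsum_mul_left, ← ENNReal.tsum_mul_right]
          rw [ENNReal.tsum_comm]
          simp only [mul_assoc]
      _ = (∑' c : ℕ, (x n * y) ^ c) *
            ∑' ρ, stripWeight (x n) ρ ν * ∑' κ, stripWeight y ρ κ * schurSum n x κ := by
          simp only [tsum_stripWeight_mul_stripWeight, mul_assoc, ENNReal.tsum_mul_left]
          congr 1
          simp only [← ENNReal.tsum_mul_left, ← ENNReal.tsum_mul_right]
          rw [ENNReal.tsum_comm]
          refine tsum_congr fun ρ => tsum_congr fun κ => by ring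
      _ = _ := by
          simp only [ih, Finset.prod_range_succ, schurSum_succ]
          generalize ∑' c : ℕ, (x n * y) ^ c = G
          simp only [← ENNReal.tsum_mul_left]
          refine tsum_congr fun ρ => by ring

theorem tsum_pow_oddRowsCount_mul_schurSum_succ (n : ℕ) (x : ℕ → ℝ≥0∞) (t : ℝ≥0∞) :
    ∑' μ, t ^ oddRowsCount μ * schurSum (n + 1) x μ =
      ((1 + t * x n) * ∏ i ∈ Finset.range (n + 1), ∑' c : ℕ, (x i * x n) ^ c) *
        ∑' μ, t ^ oddRowsCount μ * schurSum n x μ := by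
  calc ∑' μ, t ^ oddRowsCount μ * schurSum (n + 1) x μ
      = ∑' κ, (∑' μ, stripWeight (x n) κ μ * t ^ oddRowsCount μ) * schurSum n x κ := by
        simp only [schurSum_succ, ← ENNReal.tsum_mul_left, ← ENNReal.tsum_mul_right]
        rw [ENNReal.tsum_comm]
        refine tsum_congr fun ρ => tsum_congr fun κ => by ring
    _ = ((1 + t * x n) * ∑' c : ℕ, (x n * x n) ^ c) *
          ∑' ν, t ^ oddRowsCount ν * ∑' κ, stripWeight (x n) ν κ * schurSum n x κ := by
        simp only [tsum_stripWeight_mul_pow_oddRowsCount, mul_assoc, ENNReal.tsum_mul_left]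
        congr 2
        simp only [← ENNReal.tsum_mul_left, ← ENNReal.tsum_mul_right]
        rw [ENNReal.tsum_comm]
        refine tsum_congr fun ρ => tsum_congr fun κ => by ring
    _ = _ := by
        simp only [tsum_stripWeight_mul_schurSum, Finset.prod_range_succ]
        generalize ∑' c : ℕ, (x n * x n) ^ c = G
        simp only [← ENNReal.tsum_mul_left]
        refine tsum_congr fun ρ => by ring

theorem oddRowsCount_bot : oddRowsCount ⊥ = 0 := by
  have h : (⊥ : YoungDiagram).colLen 0 = 0 := by
    by_contra h0
    exact notMem_bot _ (mem_iff_lt_colLen.mpr (Nat.pos_of_ne_zero h0))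
  rw [oddRowsCount_eq_sum ⊥ h.le, Finset.sum_range_zero]

theorem tsum_pow_oddRowsCount_mul_schurSum (n : ℕ) (x : ℕ → ℝ≥0∞) (t : ℝ≥0∞) :
    ∑' μ, t ^ oddRowsCount μ * schurSum n x μ =
      (∏ j ∈ Finset.range n, (1 + t * x j)) *
        ∏ j ∈ Finset.range n, ∏ i ∈ Finset.range (j + 1), ∑' c : ℕ, (x i * x j) ^ c := by
  induction n with
  | zero =>
    rw [tsum_eq_single ⊥ fun μ h => by rw [schurSum_zero_of_ne_bot x h, mul_zero],
      schurSum_zero_bot, oddRowsCount_bot]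
    simp
  | succ n ih =>
    rw [tsum_pow_oddRowsCount_mul_schurSum_succ, ih,
      Finset.prod_range_succ (fun j => 1 + t * x j),
      Finset.prod_range_succ (fun j => ∏ i ∈ Finset.range (j + 1), _)]
    ring

end YoungDiagram

namespace ENNReal

open scoped ENNReal

theorem apply_zero_eq_of_tsum_pow_mul_eq {a b : ℕ → ℝ≥0∞} {s₀ : ℝ≥0∞} (hs₀ : s₀ ≠ 0)
    (h_top : ∑' m, s₀ ^ m * a m ≠ ⊤)
    (h : ∀ s ≠ 0, s ≤ s₀ → ∑' m, s ^ m * a m = ∑' m, s ^ m * b m) : b 0 ≤ a 0 := by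
  set C := ∑' m, s₀ ^ m * a (m + 1) with hC
  have hC_top : C ≠ ⊤ := by
    intro hC'
    refine h_top ?_
    rw [tsum_eq_zero_add' ENNReal.summable]
    have : ∑' m, s₀ ^ (m + 1) * a (m + 1) = s₀ * C := by
      rw [hC, ← ENNReal.tsum_mul_left]
      exact tsum_congr fun m => by ring
    rw [this, hC', ENNReal.mul_top hs₀, add_top]
  have hle : ∀ s ≠ 0, s ≤ s₀ → b 0 ≤ a 0 + s * C := by
    intro s hs hss
    calc b 0 ≤ ∑' m, s ^ m * b m := by
          simpa using ENNReal.le_tsum (f := fun m => s ^ m * b m) 0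
      _ = a 0 + ∑' m, s ^ (m + 1) * a (m + 1) := by
          rw [← h s hs hss, tsum_eq_zero_add' ENNReal.summable, pow_zero, one_mul]
      _ = a 0 + s * ∑' m, s ^ m * a (m + 1) := by
          rw [← ENNReal.tsum_mul_left]
          exact congrArg _ (tsum_congr fun m => by ring)
      _ ≤ a 0 + s * C := by
          rw [hC]
          gcongr
  have hlim : Filter.Tendsto (fun s => a 0 + s * C) (nhdsWithin 0 (Set.Ioi 0)) (nhds (a 0)) := by
    have : Filter.Tendsto (fun s => a 0 + s * C) (nhds 0) (nhds (a 0 + 0 * C)) :=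
      tendsto_const_nhds.add
        (ENNReal.Tendsto.mul_const Filter.tendsto_id (Or.inr hC_top))
    rw [zero_mul, add_zero] at this
    exact this.mono_left nhdsWithin_le_nhds
  refine ge_of_tendsto hlim ?_
  filter_upwards [Ioc_mem_nhdsGT (pos_iff_ne_zero.2 hs₀)] with s hs
  exact hle s hs.1.ne' hs.2

/-- Two power series with extended nonnegative coefficients that agree, and are finite, near `0`
have the same coefficients. -/
theorem eq_of_tsum_pow_mul_eq {a b : ℕ → ℝ≥0∞} {s₀ : ℝ≥0∞} (hs₀ : s₀ ≠ 0) (hs₀_top : s₀ ≠ ⊤)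
    (h_top : ∑' m, s₀ ^ m * a m ≠ ⊤)
    (h : ∀ s ≠ 0, s ≤ s₀ → ∑' m, s ^ m * a m = ∑' m, s ^ m * b m) (m : ℕ) : a m = b m := by
  induction m generalizing a b with
  | zero =>
    refine le_antisymm (apply_zero_eq_of_tsum_pow_mul_eq hs₀ ?_ fun s hs hss => (h s hs hss).symm)
      (apply_zero_eq_of_tsum_pow_mul_eq hs₀ h_top h)
    rwa [← h s₀ hs₀ le_rfl]
  | succ m ih =>
    have h₀ : a 0 = b 0 :=
      le_antisymm (apply_zero_eq_of_tsum_pow_mul_eq hs₀ (by rwa [← h s₀ hs₀ le_rfl])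
        fun s hs hss => (h s hs hss).symm) (apply_zero_eq_of_tsum_pow_mul_eq hs₀ h_top h)
    have hshift : ∀ (s : ℝ≥0∞) (f : ℕ → ℝ≥0∞),
        ∑' m, s ^ m * f m = f 0 + s * ∑' m, s ^ m * f (m + 1) := by
      intro s f
      rw [tsum_eq_zero_add' ENNReal.summable, pow_zero, one_mul, ← ENNReal.tsum_mul_left]
      exact congrArg _ (tsum_congr fun m => by ring)
    have ha₀ : a 0 ≠ ⊤ := by
      intro h'
      rw [hshift, h', top_add] at h_top
      exact h_top rfl
    refine ih (a := fun m => a (m + 1)) (b := fun m => b (m + 1)) ?_ fun s hs hss => ?_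
    · intro h'
      rw [hshift, h', ENNReal.mul_top hs₀, add_top] at h_top
      exact h_top rfl
    · have := h s hs hss
      rw [hshift, hshift s b, ← h₀, ENNReal.add_right_inj ha₀,
        ENNReal.mul_right_inj hs (ne_top_of_le_ne_top hs₀_top hss)] at this
      exact this

theorem prod_tsum_eq_tsum_prod {σ ι : Type*} [Fintype σ] (f : σ → ι → ℝ≥0∞) :
    ∏ p, ∑' c, f p c = ∑' m : σ → ι, ∏ p, f p (m p) := by
  revert f
  refine Fintype.induction_empty_option (P := fun σ _ => ∀ f : σ → ι → ℝ≥0∞,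
    ∏ p, ∑' c, f p c = ∑' m : σ → ι, ∏ p, f p (m p)) ?_ ?_ ?_ σ
  · intro α β _ e ih f
    let := Fintype.ofEquiv _ e.symm
    rw [← e.prod_comp, ih, ← (e.arrowCongr (Equiv.refl ι)).tsum_eq]
    refine tsum_congr fun m => ?_
    rw [← e.prod_comp]
    simp
  · intro f
    rw [tsum_eq_single PEmpty.elim fun m hm => absurd (Subsingleton.elim _ _) hm]
    simp
  · intro α _ ih f
    rw [Fintype.prod_option, ih, ← (Equiv.piOptionEquivProd (β := fun _ => ι)).symm.tsum_eq,
      ENNReal.tsum_prod', ← ENNReal.tsum_mul_right]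
    refine tsum_congr fun c => ?_
    rw [← ENNReal.tsum_mul_left]
    refine tsum_congr fun m => ?_
    rw [Fintype.prod_option]
    rfl

/-- The generating function of the complete homogeneous symmetric functions. -/
theorem prod_tsum_pow_eq_tsum_sum_sym {σ : Type*} [Fintype σ] [DecidableEq σ] (z : σ → ℝ≥0∞) :
    ∏ p, ∑' c : ℕ, z p ^ c = ∑' l, ∑ s : Sym σ l, ((s : Multiset σ).map z).prod := by
  have hprod (s : Multiset σ) : ∏ p, z p ^ s.count p = (s.map z).prod := by
    rw [Finset.prod_multiset_map_count]
    refine (Finset.prod_subset (Finset.subset_univ _) fun p _ hp => ?_).symm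
    rw [Multiset.count_eq_zero_of_notMem fun h => hp (Multiset.mem_toFinset.2 h), pow_zero]
  let e : Multiset σ ≃ (σ → ℕ) := Multiset.toFinsupp.toEquiv.trans Finsupp.equivFunOnFinite
  calc ∏ p, ∑' c : ℕ, z p ^ c = ∑' s : Multiset σ, ∏ p, z p ^ s.count p := by
        rw [prod_tsum_eq_tsum_prod, ← e.tsum_eq]
        rfl
    _ = ∑' l, ∑' s : {s : Multiset σ // s.card = l}, ((s : Multiset σ).map z).prod := by
        simp only [hprod]
        rw [← (Equiv.sigmaFiberEquiv Multiset.card).tsum_eq, ENNReal.tsum_sigma']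
        rfl
    _ = ∑' l, ∑ s : Sym σ l, ((s : Multiset σ).map z).prod :=
        tsum_congr fun l => tsum_fintype (L := .unconditional _)
          (fun s : Sym σ l => ((s : Multiset σ).map z).prod)

/-- The generating function of the elementary symmetric functions. -/
theorem prod_one_add_mul_eq_tsum {σ : Type*} [Fintype σ] (t : ℝ≥0∞) (x : σ → ℝ≥0∞) :
    ∏ i, (1 + t * x i) =
      ∑' k, t ^ k * ∑ s ∈ Finset.powersetCard k Finset.univ, ∏ i ∈ s, x i := by
  rw [Finset.prod_one_add, Finset.sum_powerset, tsum_eq_sum]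
  · refine Finset.sum_congr rfl fun k _ => ?_
    rw [Finset.mul_sum]
    refine Finset.sum_congr rfl fun s hs => ?_
    rw [Finset.prod_mul_distrib, Finset.prod_const, (Finset.mem_powersetCard.1 hs).2]
  · intro k hk
    rw [Finset.powersetCard_eq_empty.2 (by simpa [Nat.lt_succ_iff] using hk), Finset.sum_empty,
      mul_zero]

end ENNReal

/-- The value of the elementary symmetric polynomial `e_k` at `x_0, …, x_{n-1}`. -/
def esymmValue {R : Type*} [CommSemiring R] (n k : ℕ) (x : ℕ → R) : R :=
  ∑ s ∈ Finset.powersetCard k (Finset.univ : Finset (Fin n)), ∏ i ∈ s, x i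

/-- The value of the complete homogeneous symmetric polynomial of degree `l` at the products
`x_i x_j` with `i ≤ j < n`. -/
def pairHsymmValue {R : Type*} [CommSemiring R] (n l : ℕ) (x : ℕ → R) : R :=
  ∑ s : Sym {p : Fin n × Fin n // p.1 ≤ p.2} l,
    ((s : Multiset {p : Fin n × Fin n // p.1 ≤ p.2}).map fun p =>
      x p.1.1 * x p.1.2).prod

theorem map_esymmValue {R S : Type*} [CommSemiring R] [CommSemiring S] (f : R →+* S) (n k : ℕ)
    (x : ℕ → R) : f (esymmValue n k x) = esymmValue n k fun i => f (x i) := by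
  simp [esymmValue, map_sum, map_prod]

theorem map_pairHsymmValue {R S : Type*} [CommSemiring R] [CommSemiring S] (f : R →+* S)
    (n l : ℕ) (x : ℕ → R) :
    f (pairHsymmValue n l x) = pairHsymmValue n l fun i => f (x i) := by
  simp [pairHsymmValue, map_sum, map_multiset_prod, Multiset.map_map]

theorem esymmValue_const_mul {R : Type*} [CommSemiring R] (n k : ℕ) (q : R) (x : ℕ → R) :
    esymmValue n k (fun i => q * x i) = q ^ k * esymmValue n k x := by
  rw [esymmValue, esymmValue, Finset.mul_sum]
  refine Finset.sum_congr rfl fun s hs => ?_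
  rw [Finset.prod_mul_distrib, Finset.prod_const, (Finset.mem_powersetCard.1 hs).2]

theorem pairHsymmValue_const_mul {R : Type*} [CommSemiring R] (n l : ℕ) (q : R) (x : ℕ → R) :
    pairHsymmValue n l (fun i => q * x i) = q ^ (2 * l) * pairHsymmValue n l x := by
  rw [pairHsymmValue, pairHsymmValue, Finset.mul_sum]
  refine Finset.sum_congr rfl fun s _ => ?_
  have h (p : {p : Fin n × Fin n // p.1 ≤ p.2}) :
      q * x p.1.1 * (q * x p.1.2) = q ^ 2 * (x p.1.1 * x p.1.2) := by ring
  simp only [h]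
  rw [Multiset.prod_map_mul, Multiset.map_const', Multiset.prod_replicate, Sym.card_coe, pow_mul]

theorem Finset.prod_range_prod_range_succ_eq_prod_subtype {M : Type*} [CommMonoid M] (n : ℕ)
    (f : ℕ → ℕ → M) :
    ∏ j ∈ Finset.range n, ∏ i ∈ Finset.range (j + 1), f i j =
      ∏ p : {p : Fin n × Fin n // p.1 ≤ p.2}, f p.1.1 p.1.2 := by
  rw [← Finset.prod_subtype (Finset.univ.filter fun p : Fin n × Fin n => p.1 ≤ p.2)
    (by simp) fun p => f p.1 p.2, Finset.prod_filter, Fintype.prod_prod_type_right,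
    Finset.prod_range]
  refine Finset.prod_congr rfl fun j _ => ?_
  simp only [← Fin.val_fin_le]
  rw [← Finset.prod_range (fun i => if i ≤ (j : ℕ) then f i j else 1), ← Finset.prod_filter]
  refine Finset.prod_congr ?_ fun _ _ => rfl
  ext i
  simp only [Finset.mem_range, Finset.mem_filter]
  omega

namespace YoungDiagram

open scoped ENNReal

theorem prod_mul_prod_eq_tsum_mul_tsum (n : ℕ) (x : ℕ → ℝ≥0∞) (t : ℝ≥0∞) :
    (∏ j ∈ Finset.range n, (1 + t * x j)) *
        ∏ j ∈ Finset.range n, ∏ i ∈ Finset.range (j + 1), ∑' c : ℕ, (x i * x j) ^ c =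
      (∑' k, t ^ k * esymmValue n k x) * ∑' l, pairHsymmValue n l x := by
  rw [Finset.prod_range_prod_range_succ_eq_prod_subtype, Finset.prod_range,
    ENNReal.prod_one_add_mul_eq_tsum, ENNReal.prod_tsum_pow_eq_tsum_sum_sym]
  rfl

theorem schurSum_const_mul (n : ℕ) (q : ℝ≥0∞) (x : ℕ → ℝ≥0∞) (μ : YoungDiagram) :
    schurSum n (fun i => q * x i) μ = q ^ μ.card * schurSum n x μ := by
  rw [schurSum, schurSum, ← ENNReal.tsum_mul_left]
  refine tsum_congr fun T => ?_
  rw [Finset.prod_mul_distrib, Finset.prod_const]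

open Classical in
theorem tsum_pow_mul_tsum_pow_mul_ite_schurSum (n : ℕ) (x : ℕ → ℝ≥0∞) (q t : ℝ≥0∞) :
    ∑' N, q ^ N * ∑' k, t ^ k *
        ∑' μ : YoungDiagram, (if μ.card = N ∧ oddRowsCount μ = k then schurSum n x μ else 0) =
      ∑' μ, t ^ oddRowsCount μ * schurSum n (fun i => q * x i) μ := by
  simp only [← ENNReal.tsum_mul_left]
  simp only [ENNReal.tsum_comm (α := ℕ) (β := YoungDiagram)]
  refine tsum_congr fun μ => ?_
  rw [tsum_eq_single μ.card, tsum_eq_single (oddRowsCount μ), if_pos ⟨rfl, rfl⟩,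
    schurSum_const_mul]
  · ring
  · intro k hk
    rw [if_neg fun h => hk h.2.symm, mul_zero, mul_zero]
  · intro N hN
    exact ENNReal.tsum_eq_zero.2 fun k => by
      rw [if_neg fun h => hN h.1.symm, mul_zero, mul_zero]

theorem tsum_pow_mul_tsum_pow_mul_ite_esymmValue (n : ℕ) (x : ℕ → ℝ≥0∞) (q t : ℝ≥0∞) :
    ∑' N, q ^ N * ∑' k, t ^ k *
        ∑' l, (if k + 2 * l = N then esymmValue n k x * pairHsymmValue n l x else 0) =
      (∑' k, t ^ k * esymmValue n k fun i => q * x i) *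
        ∑' l, pairHsymmValue n l fun i => q * x i := by
  simp only [← ENNReal.tsum_mul_left, ← ENNReal.tsum_mul_right]
  rw [ENNReal.tsum_comm]
  conv_rhs => rw [ENNReal.tsum_comm]
  refine tsum_congr fun k => ?_
  rw [ENNReal.tsum_comm]
  refine tsum_congr fun l => ?_
  rw [tsum_eq_single (k + 2 * l), if_pos rfl, esymmValue_const_mul, pairHsymmValue_const_mul]
  · ring
  · intro N hN
    rw [if_neg hN.symm, mul_zero, mul_zero]

theorem tsum_pow_oddRowsCount_mul_schurSum_ne_top {n : ℕ} {x : ℕ → ℝ≥0∞} {t : ℝ≥0∞}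
    (hx : ∀ i < n, x i < 1) (ht : t ≠ ⊤) :
    ∑' μ, t ^ oddRowsCount μ * schurSum n x μ ≠ ⊤ := by
  rw [tsum_pow_oddRowsCount_mul_schurSum]
  refine ENNReal.mul_ne_top (ENNReal.prod_ne_top fun j hj => ?_)
    (ENNReal.prod_ne_top fun j hj => ENNReal.prod_ne_top fun i hi => ?_)
  · exact ENNReal.add_ne_top.2 ⟨ENNReal.one_ne_top,
      ENNReal.mul_ne_top ht (hx j (Finset.mem_range.1 hj)).ne_top⟩
  · have hj' := hx j (Finset.mem_range.1 hj)
    have hi' := hx i (by rw [Finset.mem_range] at hi hj; omega)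
    rw [ENNReal.tsum_geometric, ENNReal.inv_ne_top]
    exact (tsub_pos_of_lt ((mul_le_of_le_one_right' hj'.le).trans_lt hi')).ne'

open Classical in
theorem tsum_ite_schurSum_eq (n k l : ℕ) {x : ℕ → ℝ≥0∞} (hx : ∀ i, x i ≠ ⊤) :
    ∑' μ : YoungDiagram,
        (if μ.card = k + 2 * l ∧ oddRowsCount μ = k then schurSum n x μ else 0) =
      esymmValue n k x * pairHsymmValue n l x := by
  set S := 1 + ∑ i ∈ Finset.range n, x i with hS
  have hS_top : S ≠ ⊤ := ENNReal.add_ne_top.2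
    ⟨ENNReal.one_ne_top, ENNReal.sum_ne_top.2 fun i _ => hx i⟩
  have hS_zero : S ≠ 0 := by simp [hS]
  have hq : ∀ i < n, S⁻¹ * x i < 1 := by
    intro i hi
    have hle : x i ≤ ∑ i ∈ Finset.range n, x i :=
      Finset.single_le_sum (fun _ _ => zero_le) (Finset.mem_range.2 hi)
    have hlt : x i < S := by
      rw [hS, add_comm]
      exact hle.trans_lt (ENNReal.lt_add_right
        (ENNReal.sum_ne_top.2 fun i _ => hx i) one_ne_zero)
    calc S⁻¹ * x i < S⁻¹ * S :=
          (ENNReal.mul_lt_mul_iff_right (ENNReal.inv_ne_zero.2 hS_top)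
            (ENNReal.inv_ne_top.2 hS_zero)).2 hlt
      _ = 1 := ENNReal.inv_mul_cancel hS_zero hS_top
  have hN (t : ℝ≥0∞) (ht : t ≠ ⊤) (N : ℕ) := ENNReal.eq_of_tsum_pow_mul_eq
    (a := fun N => ∑' k, t ^ k *
      ∑' μ : YoungDiagram, (if μ.card = N ∧ oddRowsCount μ = k then schurSum n x μ else 0))
    (b := fun N => ∑' k, t ^ k *
      ∑' l, (if k + 2 * l = N then esymmValue n k x * pairHsymmValue n l x else 0))
    (ENNReal.inv_ne_zero.2 hS_top) (ENNReal.inv_ne_top.2 hS_zero)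
    (by
      rw [tsum_pow_mul_tsum_pow_mul_ite_schurSum]
      exact tsum_pow_oddRowsCount_mul_schurSum_ne_top hq ht)
    (fun q _ _ => by
      rw [tsum_pow_mul_tsum_pow_mul_ite_schurSum, tsum_pow_mul_tsum_pow_mul_ite_esymmValue,
        tsum_pow_oddRowsCount_mul_schurSum, prod_mul_prod_eq_tsum_mul_tsum]) N
  have hk := ENNReal.eq_of_tsum_pow_mul_eq (s₀ := 1) one_ne_zero ENNReal.one_ne_top (by
      intro h
      refine tsum_pow_oddRowsCount_mul_schurSum_ne_top hq ENNReal.one_ne_top ?_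
      rw [← tsum_pow_mul_tsum_pow_mul_ite_schurSum, eq_top_iff]
      refine le_trans ?_ (ENNReal.le_tsum (k + 2 * l))
      rw [h, ENNReal.mul_top (pow_ne_zero _ (ENNReal.inv_ne_zero.2 hS_top))])
    (fun t _ ht => hN t (ne_top_of_le_ne_top ENNReal.one_ne_top ht) (k + 2 * l)) k
  rw [hk, tsum_eq_single l, if_pos rfl]
  intro l' hl'
  rw [if_neg (by omega)]

end YoungDiagram

namespace YoungDiagram

open scoped ENNReal

theorem fst_lt_card {μ : YoungDiagram} {c : ℕ × ℕ} (hc : c ∈ μ.cells) : c.1 < μ.card := by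
  have h : (Finset.range (c.1 + 1)).card ≤ μ.cells.card :=
    Finset.card_le_card_of_injOn (fun i => (i, c.2))
      (fun i hi => μ.isLowerSet (Prod.mk_le_mk.2
        ⟨Nat.lt_succ_iff.1 (Finset.mem_range.1 hi), le_rfl⟩) hc)
      fun i _ j _ h => (Prod.ext_iff.1 h).1
  rwa [Finset.card_range] at h

theorem snd_lt_card {μ : YoungDiagram} {c : ℕ × ℕ} (hc : c ∈ μ.cells) : c.2 < μ.card := by
  have h : (Finset.range (c.2 + 1)).card ≤ μ.cells.card :=
    Finset.card_le_card_of_injOn (fun j => (c.1, j))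
      (fun j hj => μ.isLowerSet (Prod.mk_le_mk.2
        ⟨le_rfl, Nat.lt_succ_iff.1 (Finset.mem_range.1 hj)⟩) hc)
      fun i _ j _ h => (Prod.ext_iff.1 h).2
  rwa [Finset.card_range] at h

theorem finite_card_eq (N : ℕ) : {μ : YoungDiagram | μ.card = N}.Finite := by
  refine Set.Finite.of_finite_image
    ((Finset.range N ×ˢ Finset.range N).powerset.finite_toSet.subset ?_)
    (f := cells) fun μ _ ν _ h => YoungDiagram.ext h
  rintro _ ⟨μ, rfl, rfl⟩
  refine Finset.mem_coe.2 (Finset.mem_powerset.2 fun c hc => ?_)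
  exact Finset.mem_product.2
    ⟨Finset.mem_range.2 (fst_lt_card hc), Finset.mem_range.2 (snd_lt_card hc)⟩

instance (n : ℕ) (μ : YoungDiagram) : Finite (BoundedTableau n μ) := by
  refine Finite.of_injective
    (fun (T : BoundedTableau n μ) (c : μ.cells) =>
      (⟨T.1 c.1.1 c.1.2, T.2 c.1 c.2⟩ : Fin n)) fun T T' h => ?_
  refine Subtype.ext (SemistandardYoungTableau.ext fun i j => ?_)
  by_cases hc : (i, j) ∈ μ
  · exact congrArg Fin.val (congrFun h ⟨(i, j), hc⟩)
  · rw [T.1.zeros hc, T'.1.zeros hc]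

/-- The value of the Schur polynomial at a point with natural number coordinates. -/
noncomputable def schurValue (n : ℕ) (r : ℕ → ℕ) (μ : YoungDiagram) : ℕ :=
  ∑ᶠ T : BoundedTableau n μ, ∏ c ∈ μ.cells, r (T.1 c.1 c.2)

theorem schurSum_natCast (n : ℕ) (r : ℕ → ℕ) (μ : YoungDiagram) :
    schurSum n (fun i => (r i : ℝ≥0∞)) μ = schurValue n r μ := by
  have := Fintype.ofFinite (BoundedTableau n μ)
  rw [schurSum, schurValue, tsum_fintype, finsum_eq_sum_of_fintype]
  push_cast
  rfl

theorem prod_pow_ssytWeight {R : Type*} [CommSemiring R] {n : ℕ} {μ : YoungDiagram}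
    (T : BoundedTableau n μ) (r : ℕ → R) :
    ∏ i : Fin n, r i ^ ssytWeight T.1 i = ∏ c ∈ μ.cells, r (T.1 c.1 c.2) := by
  rw [← Finset.prod_range (fun i => r i ^ ssytWeight T.1 i),
    ← Finset.prod_fiberwise_of_maps_to (g := fun c => T.1 c.1 c.2) (t := Finset.range n)
      fun c hc => Finset.mem_range.2 (T.2 c hc)]
  refine Finset.prod_congr rfl fun i _ => ?_
  rw [ssytWeight, Finset.prod_congr rfl fun c hc => by rw [(Finset.mem_filter.1 hc).2],
    Finset.prod_const]

theorem eval_schurPoly (n : ℕ) (r : ℕ → ℕ) (μ : YoungDiagram) :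
    MvPolynomial.eval (fun i : Fin n => (r i : ℤ)) (schurPoly n μ) = schurValue n r μ := by
  have := Fintype.ofFinite (BoundedTableau n μ)
  rw [schurPoly, ← finsum_subtype_eq_finsum_cond
      (fun T : SemistandardYoungTableau μ => ∀ c ∈ μ.cells, T c.1 c.2 < n),
    schurValue, finsum_eq_sum_of_fintype, finsum_eq_sum_of_fintype, map_sum, Nat.cast_sum]
  refine Finset.sum_congr rfl fun T _ => ?_
  simp only [map_prod, map_pow, MvPolynomial.eval_X]
  rw [prod_pow_ssytWeight T fun i => (r i : ℤ), Nat.cast_prod]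

theorem finite_card_eq_and_oddRowsCount_eq (k l : ℕ) :
    {μ : YoungDiagram | μ.card = k + 2 * l ∧ oddRowsCount μ = k}.Finite :=
  (finite_card_eq (k + 2 * l)).subset fun _ h => h.1

theorem sum_schurValue (n k l : ℕ) (r : ℕ → ℕ) :
    ∑ μ ∈ (finite_card_eq_and_oddRowsCount_eq k l).toFinset, schurValue n r μ =
      esymmValue n k r * pairHsymmValue n l r := by
  classical
  have h := tsum_ite_schurSum_eq n k l (x := fun i => (r i : ℝ≥0∞))
    fun i => ENNReal.natCast_ne_top _
  have he := map_esymmValue (Nat.castRingHom ℝ≥0∞) n k r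
  have hh := map_pairHsymmValue (Nat.castRingHom ℝ≥0∞) n l r
  simp only [Nat.coe_castRingHom] at he hh
  have hmem (μ : YoungDiagram) : μ ∈ (finite_card_eq_and_oddRowsCount_eq k l).toFinset ↔
      μ.card = k + 2 * l ∧ oddRowsCount μ = k := Set.Finite.mem_toFinset _
  generalize (finite_card_eq_and_oddRowsCount_eq k l).toFinset = S at hmem ⊢
  simp only [← hmem, schurSum_natCast] at h
  rw [← he, ← hh, tsum_eq_sum fun μ hμ => if_neg hμ, Finset.sum_ite_mem, Finset.inter_self] at h
  exact_mod_cast h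

end YoungDiagram

open MvPolynomial in
/-- **Character identity for `∧^k(C^n) ⊗ Sym^l(Sym² C^n)` (Burge).**
`e_k(x) · h_l({x_i x_j : i ≤ j})` equals the sum of Schur polynomials `s_λ(x_1,…,x_n)` over
partitions `λ` of `k + 2l` with exactly `k` odd rows. -/
theorem burge_refined_model_characters (n k l : ℕ) (hn : 0 < n) :
    esymm (Fin n) ℤ k *
        aeval (fun p : {p : Fin n × Fin n // p.1 ≤ p.2} =>
            (X p.1.1 : MvPolynomial (Fin n) ℤ) * X p.1.2)
          (hsymm {p : Fin n × Fin n // p.1 ≤ p.2} ℤ l) =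
      ∑ᶠ (lam : YoungDiagram) (_ : lam.card = k + 2 * l ∧ oddRowsCount lam = k),
        schurPoly n lam := by
  refine funext_set (fun _ => Set.range ((↑) : ℕ → ℤ))
    (fun _ => Set.infinite_range_of_injective Nat.cast_injective) fun y hy => ?_
  choose s hs using fun i => hy i (Set.mem_univ i)
  let r : ℕ → ℕ := fun i => if h : i < n then s ⟨i, h⟩ else 0
  obtain rfl : y = fun i : Fin n => (r i : ℤ) := by
    funext i
    simp only [r, i.2, dif_pos, Fin.eta, hs]
  have he : eval (fun i : Fin n => (r i : ℤ)) (esymm (Fin n) ℤ k) = esymmValue n k r := by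
    rw [← Nat.coe_castRingHom, map_esymmValue]
    simp [esymm, esymmValue, map_sum, map_prod]
  have hh : eval (fun i : Fin n => (r i : ℤ)) (aeval
      (fun p : {p : Fin n × Fin n // p.1 ≤ p.2} =>
        (X p.1.1 : MvPolynomial (Fin n) ℤ) * X p.1.2) (hsymm _ ℤ l)) = pairHsymmValue n l r := by
    rw [← Nat.coe_castRingHom, map_pairHsymmValue]
    simp [hsymm, pairHsymmValue, map_sum, map_multiset_prod, Multiset.map_map]
  have hsum := finsum_mem_eq_finite_toFinset_sum (schurPoly n)
    (YoungDiagram.finite_card_eq_and_oddRowsCount_eq k l)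
  simp only [Set.mem_ofPred_eq] at hsum
  rw [map_mul, he, hh, ← Nat.cast_mul, ← YoungDiagram.sum_schurValue, hsum, map_sum, Nat.cast_sum]
  exact Finset.sum_congr rfl fun μ _ => (YoungDiagram.eval_schurPoly n r μ).symm
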